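/- arXiv:2501.01567 — 2 statements merged into one kernel-verified Lean document; each statement's English description precedes it below -/
import Mathlib

section
/- Let A ⊆ B be commutative rings with conductor ideal 𝔠 = { x ∈ A : xB ⊆ A }. If x ∈ B and the residue class of x modulo 𝔠 lies in the nilradical of B/𝔠 and also satisfies x̄·(B/𝔠) ⊆ A/𝔠, then x ∈ 𝔠 (equivalently x̄ = 0). Consequently, if the natural map Nil(A/𝔠) → Nil(B/𝔠) is surjective, then Nil(A/𝔠) = Nil(B/𝔠) = 0, i.e., both A/𝔠 and B/𝔠 are reduced. -/
/-- The conductor of a subring `A ⊆ B`, `{x : xB ⊆ A}`, as an ideal of `B`. -/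
def conductorIdeal (B : Type*) [CommRing B] (A : Subring B) : Ideal B where
  carrier := {y : B | ∀ b : B, y * b ∈ A}
  add_mem' := fun {a b} ha hb b' => by
    simpa [add_mul] using A.add_mem (ha b') (hb b')
  zero_mem' := fun b' => by simpa using A.zero_mem
  smul_mem' := fun c y hy b' => by
    simp only [smul_eq_mul]
    rw [mul_comm c y, mul_assoc]
    exact hy (c * b')

/-- If `x ∈ B` has nilpotent image in `B/𝔠` and satisfies `x̄·(B/𝔠) ⊆ A/𝔠`, then `x ∈ 𝔠`.
Consequently, if `Nil(A/𝔠) → Nil(B/𝔠)` is surjective, then `B/𝔠` (and `A/𝔠`) is reduced. -/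
theorem conductor_nilpotent (B : Type*) [CommRing B] (A : Subring B) :
    (∀ x : B, IsNilpotent (Ideal.Quotient.mk (conductorIdeal B A) x) →
      (∀ b : B, ∃ a ∈ A, x * b - a ∈ conductorIdeal B A) → x ∈ conductorIdeal B A) ∧
    ((∀ y : B, IsNilpotent (Ideal.Quotient.mk (conductorIdeal B A) y) →
        ∃ a ∈ A, Ideal.Quotient.mk (conductorIdeal B A) a =
          Ideal.Quotient.mk (conductorIdeal B A) y) →
      IsReduced (B ⧸ conductorIdeal B A) ∧
      IsReduced (A ⧸ (conductorIdeal B A).comap A.subtype)) := by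
  have hle : ∀ y ∈ conductorIdeal B A, y ∈ A := fun y hy => by
    have h : y * 1 ∈ A := hy 1
    simpa using h
  have h1 : ∀ x : B, (∀ b : B, ∃ a ∈ A, x * b - a ∈ conductorIdeal B A) →
      x ∈ conductorIdeal B A := by
    intro x hx b
    obtain ⟨a, ha, hxa⟩ := hx b
    simpa using A.add_mem (hle _ hxa) ha
  refine ⟨fun x _ hx => h1 x hx, fun hs => ?_⟩
  have key : ∀ x : B, IsNilpotent (Ideal.Quotient.mk (conductorIdeal B A) x) →
      x ∈ conductorIdeal B A := by
    intro x hx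
    refine h1 x fun b => ?_
    have hn : IsNilpotent (Ideal.Quotient.mk (conductorIdeal B A) (x * b)) := by
      rw [map_mul]
      exact (Commute.all _ _).isNilpotent_mul_right hx
    obtain ⟨a, ha, hab⟩ := hs _ hn
    exact ⟨a, ha, Ideal.Quotient.eq.mp hab.symm⟩
  refine ⟨⟨fun z hz => ?_⟩, ⟨fun z hz => ?_⟩⟩
  · obtain ⟨x, rfl⟩ := Ideal.Quotient.mk_surjective z
    exact Ideal.Quotient.eq_zero_iff_mem.mpr (key x hz)
  · obtain ⟨x, rfl⟩ := Ideal.Quotient.mk_surjective z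
    obtain ⟨n, hn⟩ := hz
    rw [← map_pow, Ideal.Quotient.eq_zero_iff_mem, Ideal.mem_comap, map_pow] at hn
    refine Ideal.Quotient.eq_zero_iff_mem.mpr (Ideal.mem_comap.mpr (key _ ⟨n, ?_⟩))
    rw [← map_pow]
    exact Ideal.Quotient.eq_zero_iff_mem.mpr hn
end

section
/- Let A be a commutative ring and f, g ∈ A elements whose images in m/m² are linearly independent over A/m for some maximal ideal m containing f and g (i.e., f and g are linearly independent modulo m²). Then df ∧ dg ≠ 0 in Ω²_{A/ℚ} provided A is an essentially finite type algebra over a field k of characteristic zero and df, dg are part of a basis; more concretely: if A is a local ring with maximal ideal m, k ⊆ A a field, and f, g ∈ m have linearly independent images in m/m², then df ∧ d(gt) ≠ 0 in Ω²_{A[t]/k}. -/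
open Polynomial IsLocalRing

theorem wedge_ne_zero_aux {R S M : Type*} [CommRing R] [CommRing S] [Algebra R S]
    [AddCommGroup M] [Module R M] (φ ψ : M →ₗ[R] S) (x y : M)
    (h : φ x * ψ y - φ y * ψ x ≠ 0) :
    ExteriorAlgebra.ι R x * ExteriorAlgebra.ι R y ≠ 0 := by
  intro h0
  let alt : M [⋀^Fin 2]→ₗ[R] S :=
    { toFun := fun v => φ (v 0) * ψ (v 1) - φ (v 1) * ψ (v 0)
      map_update_add' := by
        intro inst v i a b
        rw [Subsingleton.elim inst (instDecidableEqFin 2)]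
        fin_cases i <;> simp <;> ring
      map_update_smul' := by
        intro inst v i a b
        rw [Subsingleton.elim inst (instDecidableEqFin 2)]
        fin_cases i <;> simp [smul_sub]
      map_eq_zero_of_eq' := by
        intro v i j hij hne
        fin_cases i <;> fin_cases j <;> simp_all }
  let F : ∀ i, M [⋀^Fin i]→ₗ[R] S := fun i =>
    if hi : i = 2 then hi ▸ alt else 0
  have hF : F 2 = alt := by simp [F]
  have h1 := ExteriorAlgebra.liftAlternating_apply_ιMulti F ![x, y]
  rw [hF, ExteriorAlgebra.ιMulti_apply] at h1
  simp [h0] at h1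
  apply h
  exact h1.symm

theorem formallySmooth_of_charZero_aux (k K : Type*) [Field k] [CharZero k] [Field K]
    [Algebra k K] : Algebra.FormallySmooth k K := by
  obtain ⟨s, hs⟩ := exists_isTranscendenceBasis k K
  have h2 : Algebra.IsAlgebraic (IntermediateField.adjoin k (Set.range ((↑) : s → K))) K :=
    hs.isAlgebraic_field
  have : Algebra.IsSeparable (IntermediateField.adjoin k (Set.range ((↑) : s → K))) K :=
    inferInstance
  exact .of_algebraicIndependent_of_isSeparable hs.1

theorem exists_derivation_aux (k A : Type*) [Field k] [CharZero k] [CommRing A]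
    [Algebra k A] [IsLocalRing A] :
    ∃ D : Derivation k A (CotangentSpace A), ∀ x : maximalIdeal A,
      D x = - (maximalIdeal A).toCotangent x := by
  have := formallySmooth_of_charZero_aux k (ResidueField A)
  let m := maximalIdeal A
  let p : (A ⧸ m ^ 2) →ₐ[k] ResidueField A :=
    Ideal.Quotient.liftₐ (m ^ 2) (IsScalarTower.toAlgHom k A (ResidueField A)) (by
      intro a ha
      have : a ∈ m := Ideal.pow_le_self two_ne_zero ha
      exact (residue_eq_zero_iff a).2 this)
  have hpmk : ∀ a : A, p (Ideal.Quotient.mk _ a) = residue A a := fun a => rfl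
  have hp : Function.Surjective p := by
    intro y
    obtain ⟨a, rfl⟩ := residue_surjective y
    exact ⟨Ideal.Quotient.mk _ a, hpmk a⟩
  have hker : RingHom.ker (p : (A ⧸ m ^ 2) →+* ResidueField A) = m.cotangentIdeal := by
    ext y
    obtain ⟨a, rfl⟩ := Ideal.Quotient.mk_surjective y
    rw [RingHom.mem_ker, Ideal.mk_mem_cotangentIdeal]
    exact residue_eq_zero_iff a
  have hnil : IsNilpotent (RingHom.ker (p : (A ⧸ m ^ 2) →+* ResidueField A)) :=
    ⟨2, by rw [hker]; exact m.cotangentIdeal_square⟩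
  let s := Algebra.FormallySmooth.liftOfSurjective (AlgHom.id k (ResidueField A)) p hp hnil
  have hs : ∀ y, p (s y) = y :=
    Algebra.FormallySmooth.liftOfSurjective_apply (AlgHom.id k (ResidueField A)) p hp hnil
  let l : A →ₐ[k] A ⧸ m ^ 2 := s.comp (IsScalarTower.toAlgHom k A (ResidueField A))
  have hl : (Ideal.Quotient.mkₐ k m.cotangentIdeal).comp l =
      IsScalarTower.toAlgHom k A ((A ⧸ m ^ 2) ⧸ m.cotangentIdeal) := by
    ext a
    change Ideal.Quotient.mk _ (s (residue A a)) = Ideal.Quotient.mk _ (Ideal.Quotient.mk _ a)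
    rw [Ideal.Quotient.eq, ← hker, RingHom.mem_ker, map_sub]
    change p (s (residue A a)) - p (Ideal.Quotient.mk _ a) = 0
    rw [hs, hpmk, sub_self]
  let D := derivationToSquareZeroOfLift m.cotangentIdeal m.cotangentIdeal_square l hl
  let e : m.cotangentIdeal →ₗ[A] m.Cotangent := m.cotangentEquivIdeal.symm.toLinearMap
  refine ⟨e.compDer D, fun x => ?_⟩
  change m.cotangentEquivIdeal.symm (D x) = _
  rw [LinearEquiv.symm_apply_eq, map_neg]
  apply Subtype.ext
  have h0 : residue A (x : A) = 0 := (residue_eq_zero_iff _).2 x.2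
  change s (residue A x) - Ideal.Quotient.mk _ (x : A) = - Ideal.Quotient.mk _ (x : A)
  rw [h0, map_zero, zero_sub]



/-- If `(A, m)` is a local ring containing a field `k` of characteristic zero and
`f, g ∈ m` have linearly independent images in `m/m²`, then `df ∧ d(gt) ≠ 0` in
`Ω²_{A[t]/k}` (formulated in the exterior algebra of `Ω_{A[t]/k}` over `A[t]`). -/
theorem df_wedge_dgt_ne_zero (k A : Type*) [Field k] [CharZero k] [CommRing A]
    [Algebra k A] [IsLocalRing A]
    (f g : A) (hf : f ∈ maximalIdeal A) (hg : g ∈ maximalIdeal A)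
    (hind : ∀ a b : A, a * f + b * g ∈ (maximalIdeal A) ^ 2 →
      a ∈ maximalIdeal A ∧ b ∈ maximalIdeal A) :
    ExteriorAlgebra.ι (Polynomial A)
        (KaehlerDifferential.D k (Polynomial A) (C f)) *
      ExteriorAlgebra.ι (Polynomial A)
        (KaehlerDifferential.D k (Polynomial A) (C g * X)) ≠ 0 := by

  obtain ⟨D, hD⟩ := exists_derivation_aux k A
  let u : CotangentSpace A := (maximalIdeal A).toCotangent ⟨f, hf⟩
  let v : CotangentSpace A := (maximalIdeal A).toCotangent ⟨g, hg⟩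
  have hli : LinearIndependent (ResidueField A) ![u, v] := by
    rw [LinearIndependent.pair_iff]
    intro a b hab
    obtain ⟨a, rfl⟩ := residue_surjective a
    obtain ⟨b, rfl⟩ := residue_surjective b
    rw [residue_eq_zero_iff, residue_eq_zero_iff]
    apply hind
    have h1 : (maximalIdeal A).toCotangent (a • ⟨f, hf⟩ + b • ⟨g, hg⟩) = 0 := by
      rw [map_add, map_smul, map_smul]
      exact hab
    exact (Ideal.toCotangent_eq_zero _ _).1 h1
  obtain ⟨r, hr⟩ := LinearMap.exists_leftInverse_of_injective
    (Finsupp.linearCombination (ResidueField A) ![u, v]) (LinearMap.ker_eq_bot.2 hli)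
  have hru : r u = Finsupp.single 0 1 := by
    have := LinearMap.congr_fun hr (Finsupp.single 0 1)
    simpa using this
  have hrv : r v = Finsupp.single 1 1 := by
    have := LinearMap.congr_fun hr (Finsupp.single 1 1)
    simpa using this
  let φ : CotangentSpace A →ₗ[ResidueField A] ResidueField A := (Finsupp.lapply 0).comp r
  let ψ : CotangentSpace A →ₗ[ResidueField A] ResidueField A := (Finsupp.lapply 1).comp r
  have hφu : φ u = 1 := by simp [φ, hru]
  have hφv : φ v = 0 := by simp [φ, hrv]
  have hψu : ψ u = 0 := by simp [ψ, hru]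
  have hψv : ψ v = 1 := by simp [ψ, hrv]
  let D1 : Derivation k A (ResidueField A) := (φ.restrictScalars A).compDer D
  let D2 : Derivation k A (ResidueField A) := (ψ.restrictScalars A).compDer D
  let : Algebra A[X] A := (aeval (1 : A)).toAlgebra
  have halg : ∀ q : A[X], algebraMap A[X] A q = aeval (1 : A) q := fun _ => rfl
  have : IsScalarTower A[X] A (ResidueField A) := IsScalarTower.of_algebraMap_eq fun _ => rfl
  have : IsScalarTower k A[X] A := IsScalarTower.of_algebraMap_eq fun c => by
    rw [halg, IsScalarTower.algebraMap_apply k A A[X], Polynomial.algebraMap_eq, aeval_C]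
    rfl
  have : IsScalarTower k A[X] (ResidueField A) := IsScalarTower.of_algebraMap_eq fun c => by
    rw [IsScalarTower.algebraMap_apply A[X] A (ResidueField A),
      ← IsScalarTower.algebraMap_apply k A[X] A, ← IsScalarTower.algebraMap_apply]
  have key : ∀ (E : Derivation k A (ResidueField A)) (q : A[X]),
      (E.compAlgebraMap A[X]).liftKaehlerDifferential (KaehlerDifferential.D k A[X] q) =
        E (aeval (1 : A) q) := by
    intro E q
    rw [Derivation.liftKaehlerDifferential_comp_D]
    rfl
  apply wedge_ne_zero_aux (D1.compAlgebraMap A[X]).liftKaehlerDifferential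
    (D2.compAlgebraMap A[X]).liftKaehlerDifferential
  have hDf : D f = - u := hD ⟨f, hf⟩
  have hDg : D g = - v := hD ⟨g, hg⟩
  have e1 : D1 f = -1 := by
    change φ (D f) = _
    rw [hDf, map_neg, hφu]
  have e2 : D1 g = 0 := by
    change φ (D g) = _
    rw [hDg, map_neg, hφv, neg_zero]
  have e3 : D2 f = 0 := by
    change ψ (D f) = _
    rw [hDf, map_neg, hψu, neg_zero]
  have e4 : D2 g = -1 := by
    change ψ (D g) = _
    rw [hDg, map_neg, hψv]
  simp only [key, map_mul, aeval_C, aeval_X, mul_one, Algebra.algebraMap_self, RingHom.id_apply,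
    e1, e2, e3, e4]
  simp
end
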